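/- Let d ≥ 3 and let f : {1, …, d} → ℝ satisfy ∑_{i=1}^d f(i) = 0. Then Ent_π(f²) ≤ ((d−1)/d) · δ_d · E(f,f), where δ_d = log(d/2) if d ≤ 6 and δ_d = ((d−2)/d) log(d−1) if d ≥ 7. -/

import Mathlib

/-- The gap in the quadratic bound `2 w² log w ≤ k (w - 1)² + 2 (w - 1)`, divided by `w²`. -/
noncomputable def logGap (k w : ℝ) : ℝ :=
  k * (1 - w⁻¹) ^ 2 + 2 * w⁻¹ * (1 - w⁻¹) - 2 * Real.log w

lemma sq_mul_logGap (k : ℝ) {w : ℝ} (hw : w ≠ 0) :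
    w ^ 2 * logGap k w = k * (w - 1) ^ 2 + 2 * (w - 1) - 2 * w ^ 2 * Real.log w := by
  unfold logGap
  field_simp

lemma logGap_one (k : ℝ) : logGap k 1 = 0 := by simp [logGap]

lemma hasDerivAt_logGap (k : ℝ) {w : ℝ} (hw : w ≠ 0) :
    HasDerivAt (logGap k) (-(2 * (w⁻¹) ^ 3 * (w - 1) * (w + 2 - k))) w := by
  have h1 := hasDerivAt_inv hw
  have h2 := Real.hasDerivAt_log hw
  have h := (((h1.const_sub 1).pow 2).const_mul k).add ((h1.const_mul 2).mul (h1.const_sub 1))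
  have h' := h.sub (h2.const_mul 2)
  refine h'.congr_deriv ?_
  norm_num
  field_simp
  ring

lemma logGap_antitoneOn_Ici {k : ℝ} (hk : 3 ≤ k) : AntitoneOn (logGap k) (Set.Ici (k - 2)) := by
  refine antitoneOn_of_hasDerivWithinAt_nonpos (convex_Ici _)
    (f' := fun w => -(2 * (w⁻¹) ^ 3 * (w - 1) * (w + 2 - k))) ?_ ?_ ?_
  · intro w hw
    have hw : k - 2 ≤ w := hw
    exact (hasDerivAt_logGap k (by linarith)).continuousAt.continuousWithinAt
  · intro w hw
    rw [interior_Ici, Set.mem_Ioi] at hw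
    exact (hasDerivAt_logGap k (by linarith)).hasDerivWithinAt
  · intro w hw
    rw [interior_Ici, Set.mem_Ioi] at hw
    have h0 : 0 < w := by linarith
    have h1 : 0 ≤ w - 1 := by linarith
    have h2 : 0 ≤ w + 2 - k := by linarith
    have : 0 ≤ 2 * (w⁻¹) ^ 3 * (w - 1) * (w + 2 - k) := by positivity
    linarith

lemma logGap_monotoneOn_Icc (k : ℝ) : MonotoneOn (logGap k) (Set.Icc 1 (k - 2)) := by
  refine monotoneOn_of_hasDerivWithinAt_nonneg (convex_Icc _ _)
    (f' := fun w => -(2 * (w⁻¹) ^ 3 * (w - 1) * (w + 2 - k))) ?_ ?_ ?_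
  · intro w hw
    exact (hasDerivAt_logGap k (by linarith [hw.1])).continuousAt.continuousWithinAt
  · intro w hw
    rw [interior_Icc] at hw
    exact (hasDerivAt_logGap k (by linarith [hw.1])).hasDerivWithinAt
  · intro w hw
    rw [interior_Icc] at hw
    have h0 : 0 < w := by linarith [hw.1]
    have h1 : 0 ≤ w - 1 := by linarith [hw.1]
    have h2 : 0 ≤ k - 2 - w := by linarith [hw.2]
    have : 0 ≤ 2 * (w⁻¹) ^ 3 * (w - 1) * (k - 2 - w) := by positivity
    linarith

lemma logGap_antitoneOn_Ioc {k : ℝ} (hk : 3 ≤ k) : AntitoneOn (logGap k) (Set.Ioc 0 1) := by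
  refine antitoneOn_of_hasDerivWithinAt_nonpos (convex_Ioc _ _)
    (f' := fun w => -(2 * (w⁻¹) ^ 3 * (w - 1) * (w + 2 - k))) ?_ ?_ ?_
  · intro w hw
    exact (hasDerivAt_logGap k hw.1.ne').continuousAt.continuousWithinAt
  · intro w hw
    rw [interior_Ioc] at hw
    exact (hasDerivAt_logGap k hw.1.ne').hasDerivWithinAt
  · intro w hw
    rw [interior_Ioc] at hw
    have h0 : 0 < w := hw.1
    have h1 : 0 ≤ 1 - w := by linarith [hw.2]
    have h2 : 0 ≤ k - 2 - w := by linarith [hw.2]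
    have : 0 ≤ 2 * (w⁻¹) ^ 3 * (1 - w) * (k - 2 - w) := by positivity
    linarith

lemma logGap_nonneg {k R w : ℝ} (hk : 3 ≤ k) (hR : 0 ≤ logGap k R) (hw : 0 < w) (hwR : w ≤ R) :
    0 ≤ logGap k w := by
  rcases le_total w 1 with h | h
  · rw [← logGap_one k]
    exact logGap_antitoneOn_Ioc hk ⟨hw, h⟩ ⟨one_pos, le_rfl⟩ h
  rcases le_total w (k - 2) with h' | h'
  · rw [← logGap_one k]
    exact logGap_monotoneOn_Icc k ⟨le_rfl, by linarith⟩ ⟨h, h'⟩ h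
  · exact hR.trans (logGap_antitoneOn_Ici hk h' (h'.trans hwR) hwR)

lemma sq_mul_log_le {k R w : ℝ} (hk : 3 ≤ k) (hR : 0 ≤ logGap k R) (hwR : |w| ≤ R) :
    2 * w ^ 2 * Real.log w ≤ k * (w - 1) ^ 2 + 2 * (w - 1) := by
  rcases eq_or_ne w 0 with rfl | hw
  · norm_num
    linarith
  have hpos : 0 < |w| := abs_pos.2 hw
  have h := mul_nonneg (sq_nonneg |w|) (logGap_nonneg hk hR hpos hwR)
  rw [sq_mul_logGap k hpos.ne', Real.log_abs, sq_abs] at h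
  have h1 : 0 ≤ (k - 1) * (|w| - w) := mul_nonneg (by linarith) (by linarith [le_abs_self w])
  nlinarith [sq_abs w]

/-- Summed form of `sq_mul_log_le`, at scale `v`. -/
lemma sum_sq_mul_log_le {ι : Type*} (s : Finset ι) (y : ι → ℝ) {k R v : ℝ} (hk : 3 ≤ k)
    (hR : 0 ≤ logGap k R) (hv : 0 < v) (hy : ∀ i ∈ s, |y i| ≤ R * v) :
    ∑ i ∈ s, 2 * y i ^ 2 * Real.log (y i) ≤
      2 * (∑ i ∈ s, y i ^ 2) * Real.log v +
        k * (∑ i ∈ s, y i ^ 2 - 2 * v * ∑ i ∈ s, y i + s.card * v ^ 2) +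
        2 * v * (∑ i ∈ s, y i - s.card * v) := by
  have key : ∀ i ∈ s, 2 * y i ^ 2 * Real.log (y i) ≤
      2 * y i ^ 2 * Real.log v + k * (y i ^ 2 - 2 * v * y i + v ^ 2) + 2 * v * (y i - v) := by
    intro i hi
    have h := sq_mul_log_le (w := y i / v) hk hR (by
      rw [abs_div, abs_of_pos hv, div_le_iff₀ hv]
      exact hy i hi)
    rcases eq_or_ne (y i) 0 with h0 | h0
    · rw [h0]
      norm_num
      nlinarith [sq_nonneg v]
    rw [Real.log_div h0 hv.ne'] at h
    have h2 := mul_le_mul_of_nonneg_left h (sq_nonneg v)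
    field_simp at h2
    linarith
  refine (Finset.sum_le_sum key).trans (le_of_eq ?_)
  simp only [Finset.sum_add_distrib, ← Finset.mul_sum, ← Finset.sum_mul, Finset.sum_sub_distrib,
    Finset.sum_const, nsmul_eq_mul]

lemma two_mul_log_le_sub_inv {r : ℝ} (hr : 1 ≤ r) : 2 * Real.log r ≤ r - r⁻¹ := by
  have h := Real.self_le_sinh_iff.2 (Real.log_nonneg hr)
  rw [Real.sinh_log (by linarith)] at h
  linarith

/-- A lower bound for the binary entropy in terms of the Hellinger affinity. -/
lemma log_two_sub_le_entropy {a b : ℝ} (hb : 0 < b) (hab : b ≤ a) (h1 : a ^ 2 + b ^ 2 = 1) :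
    Real.log 2 - (a - b) ^ 2 ≤ -(2 * a ^ 2 * Real.log a) - 2 * b ^ 2 * Real.log b := by
  have ha : 0 < a := hb.trans_le hab
  let F : ℝ → ℝ := fun t => Real.log (1 + t ^ 2) - Real.log 2 - 2 * t ^ 2 * Real.log t / (1 + t ^ 2)
    + (t - 1) ^ 2 / (1 + t ^ 2)
  have hF : ∀ t : ℝ, 1 ≤ t → HasDerivAt F
      (2 * (t ^ 2 - 1 - 2 * t * Real.log t) / (1 + t ^ 2) ^ 2) t := by
    intro t ht
    have h0 : t ≠ 0 := by linarith
    have hpos : 0 < 1 + t ^ 2 := by positivity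
    have e1 : HasDerivAt (fun t : ℝ => 1 + t ^ 2) (2 * t) t := by
      simpa using (hasDerivAt_pow 2 t).const_add 1
    have e2 : HasDerivAt (fun t : ℝ => 2 * t ^ 2) (4 * t) t := by
      refine ((hasDerivAt_pow 2 t).const_mul 2).congr_deriv ?_
      norm_num
      ring
    have e3 : HasDerivAt (fun t : ℝ => (t - 1) ^ 2) (2 * (t - 1)) t := by
      refine (((hasDerivAt_id t).sub_const 1).pow 2).congr_deriv ?_
      simp
    have e := (((e1.log hpos.ne').sub_const (Real.log 2)).sub
      ((e2.mul (Real.hasDerivAt_log h0)).div e1 hpos.ne')).add (e3.div e1 hpos.ne')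
    refine e.congr_deriv ?_
    simp only [Pi.mul_apply]
    field_simp
    ring
  have hmono : MonotoneOn F (Set.Ici 1) := by
    refine monotoneOn_of_hasDerivWithinAt_nonneg (convex_Ici _)
      (f' := fun t => 2 * (t ^ 2 - 1 - 2 * t * Real.log t) / (1 + t ^ 2) ^ 2) ?_ ?_ ?_
    · exact fun t ht => (hF t ht).continuousAt.continuousWithinAt
    · intro t ht
      rw [interior_Ici, Set.mem_Ioi] at ht
      exact (hF t ht.le).hasDerivWithinAt
    · intro t ht
      rw [interior_Ici, Set.mem_Ioi] at ht
      have h0 : 0 < t := by linarith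
      have h := mul_le_mul_of_nonneg_left (two_mul_log_le_sub_inv ht.le) h0.le
      have e : t * (t - t⁻¹) = t ^ 2 - 1 := by field_simp
      have : 0 ≤ t ^ 2 - 1 - 2 * t * Real.log t := by linarith
      positivity
  have hr : 1 ≤ a / b := by rwa [one_le_div hb]
  have h := hmono (Set.mem_Ici.2 le_rfl) (Set.mem_Ici.2 hr) hr
  have e : 1 + (a / b) ^ 2 = (b ^ 2)⁻¹ := by
    field_simp
    linarith
  have hF1 : F 1 = 0 := by norm_num [F]
  rw [hF1] at h
  simp only [F, e, Real.log_inv, Real.log_pow, Real.log_div ha.ne' hb.ne'] at h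
  field_simp at h
  push_cast at h
  have e2 : a ^ 2 = 1 - b ^ 2 := by linarith
  rw [e2] at h ⊢
  nlinarith

lemma sum_sq_mul_log_le_of_two_large {ι : Type*} (s : Finset ι) (y : ι → ℝ) {a b N κ : ℝ}
    (hb : 0 < b) (hab : b < a) (hN : 0 < N) (hcard : (s.card : ℝ) ≤ N + 1) (h1 : a ^ 2 + b ^ 2 = 1)
    (hsum : ∑ i ∈ s, y i = a) (hsq : ∑ i ∈ s, y i ^ 2 = b ^ 2) (hκ : 3 ≤ κ)
    (hR1 : 1 < N * b / (a - b)) (hgap : logGap κ (N * b / (a - b)) ≤ 0) :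
    2 * a ^ 2 * Real.log a + ∑ i ∈ s, 2 * y i ^ 2 * Real.log (y i) ≤
      (a - b) ^ 2 * (1 - κ / N) - Real.log 2 := by
  have hΔ : 0 < a - b := by linarith
  set R := N * b / (a - b) with hR
  set v := (a - b) / N with hv
  have hv0 : 0 < v := by positivity
  have hRv : R * v = b := by
    rw [hR, hv]
    field_simp
  have hNv : N * v = a - b := by
    rw [hv]
    field_simp
  have hR0 : R ≠ 0 := by linarith
  have hRm : 0 < (R - 1) ^ 2 := by
    have : 0 < R - 1 := by linarith
    positivity
  obtain ⟨k, hk⟩ : ∃ k, k * (R - 1) ^ 2 = 2 * R ^ 2 * Real.log R - 2 * (R - 1) :=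
    ⟨(2 * R ^ 2 * Real.log R - 2 * (R - 1)) / (R - 1) ^ 2, div_mul_cancel₀ _ hRm.ne'⟩
  have hκk : κ ≤ k := by
    have h := mul_nonpos_of_nonneg_of_nonpos (sq_nonneg R) hgap
    rw [sq_mul_logGap κ hR0] at h
    refine le_of_mul_le_mul_right ?_ hRm
    linarith
  have hRk : 0 ≤ logGap k R := by
    have h := sq_mul_logGap k hR0
    have : R ^ 2 * logGap k R = 0 := by rw [h, hk]; ring
    rcases mul_eq_zero.1 this with h | h
    · exact absurd h (by positivity)
    · exact h.ge
  have hy : ∀ i ∈ s, |y i| ≤ R * v := by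
    intro i hi
    rw [hRv]
    refine abs_le_of_sq_le_sq ?_ hb.le
    rw [← hsq]
    exact Finset.single_le_sum (f := fun i => y i ^ 2) (fun _ _ => sq_nonneg _) hi
  have h := sum_sq_mul_log_le s y (hκ.trans hκk) hRk hv0 hy
  rw [hsum, hsq] at h
  have hent := log_two_sub_le_entropy hb hab.le h1
  have hlog : Real.log R = Real.log b - Real.log v := by
    rw [← hRv, Real.log_mul hR0 hv0.ne']
    ring
  have hk2 : k * (b - v) ^ 2 = 2 * b ^ 2 * (Real.log b - Real.log v) - 2 * v * (b - v) := by
    rw [← hlog, ← hRv]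
    linear_combination v ^ 2 * hk
  have hc : 0 ≤ (k - 2) * v ^ 2 * (N + 1 - s.card) :=
    mul_nonneg (mul_nonneg (by linarith) (sq_nonneg v)) (by linarith)
  have hkΔ : (a - b) ^ 2 * (κ / N) ≤ k * v * (a - b) := by
    have : (a - b) ^ 2 * (κ / N) = κ * (v * (a - b)) := by
      rw [hv]
      ring
    rw [this, mul_assoc]
    exact mul_le_mul_of_nonneg_right hκk (by positivity)
  have hid : 2 * b ^ 2 * Real.log v + k * (b ^ 2 - 2 * v * a + s.card * v ^ 2) +
      2 * v * (a - s.card * v) = 2 * b ^ 2 * Real.log b - k * v * (a - b)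
        - (k - 2) * v ^ 2 * (N + 1 - s.card) := by
    linear_combination hk2 + (k - 2) * v * hNv
  linarith

lemma sum_sq_mul_log_le_of_one_large {ι : Type*} (s : Finset ι) (y : ι → ℝ) {a k n : ℝ}
    (ha : 0 < a) (hn : 0 < n) (hcard : (s.card : ℝ) = n)
    (hsum : ∑ i ∈ s, y i = a) (hsq : ∑ i ∈ s, y i ^ 2 = 1 - a ^ 2) (hk3 : 3 ≤ k)
    (ha2 : 4 / 5 ≤ a ^ 2) (hk : k = 1 + 2 * n / (n + 1) * Real.log n)
    (hgap : 0 ≤ logGap k (n / 2)) :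
    2 * a ^ 2 * Real.log a + ∑ i ∈ s, 2 * y i ^ 2 * Real.log (y i) ≤
      (n - 1) / (n + 1) * Real.log n - Real.log (n + 1) := by
  have hv0 : 0 < a / n := by positivity
  have hy : ∀ i ∈ s, |y i| ≤ n / 2 * (a / n) := by
    intro i hi
    have e : n / 2 * (a / n) = a / 2 := by field_simp
    rw [e]
    refine abs_le_of_sq_le_sq ?_ (by linarith)
    have : y i ^ 2 ≤ ∑ i ∈ s, y i ^ 2 :=
      Finset.single_le_sum (f := fun i => y i ^ 2) (fun _ _ => sq_nonneg _) hi
    nlinarith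
  have h := sum_sq_mul_log_le s y hk3 hgap hv0 hy
  rw [hsum, hsq, hcard, Real.log_div ha.ne' hn.ne'] at h
  have hx : 0 < a ^ 2 * (n + 1) / n := by positivity
  have hlog := Real.log_le_sub_one_of_pos hx
  rw [Real.log_div (by positivity) hn.ne', Real.log_mul (by positivity) (by positivity),
    Real.log_pow] at hlog
  push_cast at hlog
  have hid : 2 * (1 - a ^ 2) * (Real.log a - Real.log n) +
      k * (1 - a ^ 2 - 2 * (a / n) * a + n * (a / n) ^ 2) + 2 * (a / n) * (a - n * (a / n)) =
      2 * (1 - a ^ 2) * Real.log a + (1 - a ^ 2 * (n + 1) / n)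
        + ((n - 1) / (n + 1) - 1) * Real.log n := by
    rw [hk]
    field_simp
    ring
  rw [hid] at h
  linarith

lemma log_le_affine {x c : ℝ} (hc : 0 < c) (hx : 0 < x) : Real.log x ≤ Real.log c + (x / c - 1) := by
  have h := Real.log_le_sub_one_of_pos (div_pos hx hc)
  rw [Real.log_div hx.ne' hc.ne'] at h
  linarith

lemma log_six_le : Real.log 6 ≤ 1.7927 := by
  have h := Real.log_le_log (by norm_num) (show (6 : ℝ) ^ 29 ≤ 2 ^ 75 by norm_num)
  rw [Real.log_pow, Real.log_pow] at h
  push_cast at h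
  linarith [Real.log_two_lt_d9]

lemma log_five_ge : 1.6 ≤ Real.log 5 := by
  have h := Real.log_le_log (by norm_num) (show (2 : ℝ) ^ 37 ≤ 5 ^ 16 by norm_num)
  rw [Real.log_pow, Real.log_pow] at h
  push_cast at h
  linarith [Real.log_two_gt_d9]

lemma logGap_nonpos_of_five_le {R : ℝ} (hR : 5 ≤ R) : logGap (9 / 2) R ≤ 0 := by
  refine (logGap_antitoneOn_Ici (by norm_num) (by norm_num [Set.mem_Ici])
    (Set.mem_Ici.2 (by linarith)) hR).trans ?_
  have := log_five_ge
  unfold logGap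
  norm_num at this ⊢
  linarith

lemma logGap_four_nonpos {R : ℝ} (hR : 3.236 ≤ R) : logGap 4 R ≤ 0 := by
  refine (logGap_antitoneOn_Ici (by norm_num) (by norm_num [Set.mem_Ici])
    (Set.mem_Ici.2 (by norm_num at hR ⊢; linarith)) hR).trans ?_
  have h := Real.log_le_log (by norm_num) (show (2 : ℝ) ^ 27 ≤ 3.236 ^ 16 by norm_num)
  rw [Real.log_pow, Real.log_pow] at h
  push_cast at h
  have h2 := Real.log_two_gt_d9
  unfold logGap
  norm_num at h h2 ⊢
  linarith

lemma logGap_half_nonneg {n k : ℝ} (hn : 6 ≤ n) (hk : k = 1 + 2 * n / (n + 1) * Real.log n) :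
    0 ≤ logGap k (n / 2) := by
  have h := sq_mul_logGap k (w := n / 2) (by linarith)
  have hpos : 0 < (n / 2) ^ 2 := by positivity
  rw [Real.log_div (by linarith) (by norm_num)] at h
  refine nonneg_of_mul_nonneg_right (a := (n / 2) ^ 2) ?_ hpos
  rw [h]
  have hL := log_le_affine (x := n) (c := 6) (by norm_num) (by linarith)
  have h6 := log_six_le
  have h2 := Real.log_two_gt_d9
  have hL' : Real.log n ≤ n / 6 + 0.7927 := by linarith
  have hid : k * (n / 2 - 1) ^ 2 + 2 * (n / 2 - 1) - 2 * (n / 2) ^ 2 * (Real.log n - Real.log 2) =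
      ((n + 1) * (n ^ 2 * (1 + 2 * Real.log 2) - 4) - 2 * n * (5 * n - 4) * Real.log n)
        / (4 * (n + 1)) := by
    rw [hk]
    field_simp
    ring
  rw [hid]
  refine div_nonneg ?_ (by linarith)
  have e1 : 2 * n * (5 * n - 4) * Real.log n ≤ 2 * n * (5 * n - 4) * (n / 6 + 0.7927) :=
    mul_le_mul_of_nonneg_left hL' (by nlinarith)
  have e2 : (n + 1) * (n ^ 2 * (1 + 2 * 0.693147) - 4) ≤
      (n + 1) * (n ^ 2 * (1 + 2 * Real.log 2) - 4) := by
    have : n ^ 2 * (1 + 2 * 0.693147) ≤ n ^ 2 * (1 + 2 * Real.log 2) :=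
      mul_le_mul_of_nonneg_left (by linarith) (by positivity)
    exact mul_le_mul_of_nonneg_left (by linarith) (by linarith)
  have e3 : 2 * n * (5 * n - 4) * (n / 6 + 0.7927) ≤ (n + 1) * (n ^ 2 * (1 + 2 * 0.693147) - 4) := by
    obtain ⟨m, rfl⟩ : ∃ m, n = m + 6 := ⟨n - 6, by ring⟩
    have hm : 0 ≤ m := by linarith
    have := pow_nonneg hm 3
    have := pow_nonneg hm 2
    norm_num
    nlinarith
  linarith

lemma three_le_coeff {n : ℝ} (hn : 6 ≤ n) : 3 ≤ 1 + 2 * n / (n + 1) * Real.log n := by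
  have h : Real.log 5 ≤ Real.log n := Real.log_le_log (by norm_num) (by linarith)
  have h5 := log_five_ge
  have h1 : 12 / 7 ≤ 2 * n / (n + 1) := by
    rw [div_le_div_iff₀ (by norm_num) (by linarith)]
    linarith
  nlinarith

/-- The critical entropy is below the entropy of the configurations without a dominant entry. -/
lemma critical_le {d : ℕ} (hd : 7 ≤ d) :
    Real.log 2 - 1 / 5 * (1 - 9 / 2 / ((d : ℝ) - 2)) ≥
      Real.log d - ((d : ℝ) - 2) / d * Real.log (d - 1) := by
  rcases hd.eq_or_lt with rfl | hd
  · have h := Real.log_le_sub_one_of_pos (show (0 : ℝ) < 7 ^ 7 / (6 ^ 5 * 2 ^ 7) by norm_num)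
    rw [Real.log_div (by norm_num) (by norm_num), Real.log_mul (by norm_num) (by norm_num),
      Real.log_pow, Real.log_pow, Real.log_pow] at h
    norm_num at h ⊢
    linarith
  · have hd' : (8 : ℝ) ≤ d := by exact_mod_cast hd
    obtain ⟨x, hx⟩ : ∃ x : ℝ, (d : ℝ) = x + 8 := ⟨d - 8, by ring⟩
    have hx0 : 0 ≤ x := by linarith
    rw [hx]
    have e1 : (x + 8 - 1 : ℝ) = x + 7 := by ring
    have e2 : (x + 8 - 2 : ℝ) = x + 6 := by ring
    rw [e1, e2]
    have h1 := log_le_affine (x := x + 8) (c := x + 7) (by linarith) (by linarith)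
    have h2 := log_le_affine (x := x + 7) (c := 8) (by norm_num) (by linarith)
    have h3 : Real.log 8 = 3 * Real.log 2 := by
      rw [show (8 : ℝ) = 2 ^ 3 by norm_num, Real.log_pow]
      norm_num
    have h4 := Real.log_two_lt_d9
    have h5 := Real.log_two_gt_d9
    have h6 : 2 / (x + 8) * Real.log (x + 7) ≤ 2 / (x + 8) * (1.0795 + (x + 7) / 8) :=
      mul_le_mul_of_nonneg_left (by linarith) (by positivity)
    have h7 : (x + 6) / (x + 8) * Real.log (x + 7) =
        Real.log (x + 7) - 2 / (x + 8) * Real.log (x + 7) := by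
      field_simp
      ring
    have h8 : (x + 8) / (x + 7) - 1 + 2 / (x + 8) * (1.0795 + (x + 7) / 8) ≤
        0.693 - 1 / 5 * (1 - 9 / 2 / (x + 6)) := by
      rw [← sub_nonneg]
      have : 0.693 - 1 / 5 * (1 - 9 / 2 / (x + 6)) -
          ((x + 8) / (x + 7) - 1 + 2 / (x + 8) * (1.0795 + (x + 7) / 8)) =
          ((0.493 * (x + 6) + 0.9) * (x + 7) * (x + 8) - (x + 6) * (x + 8)
            - (2 * 1.0795 + (x + 7) / 4) * (x + 6) * (x + 7)) / ((x + 6) * (x + 7) * (x + 8)) := by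
        field_simp
        ring
      rw [this]
      refine div_nonneg ?_ (by positivity)
      have := pow_nonneg hx0 3
      have := pow_nonneg hx0 2
      norm_num
      nlinarith
    linarith

/-- The optimal constant of the restricted log-Sobolev inequality. -/
noncomputable def restrictedConst (d : ℕ) : ℝ :=
  if d ≤ 6 then Real.log ((d : ℝ) / 2) else ((d - 2 : ℝ) / d) * Real.log (d - 1)

lemma neg_log_two_le_restrictedConst_sub {d : ℕ} (hd : 3 ≤ d) :
    -Real.log 2 ≤ restrictedConst d - Real.log d := by
  have hd0 : (d : ℝ) ≠ 0 := by positivity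
  unfold restrictedConst
  split_ifs with h
  · rw [Real.log_div hd0 two_ne_zero]
    linarith
  · have h7 : 7 ≤ d := by omega
    have h7' : (7 : ℝ) ≤ d := by exact_mod_cast h7
    have := critical_le h7
    have h2 : 9 / 2 / ((d : ℝ) - 2) ≤ 1 := by
      rw [div_le_one (by linarith)]
      linarith
    linarith

lemma sum_sq_mul_log_le_of_abs_le {ι : Type*} [Fintype ι] (f : ι → ℝ) {a : ℝ}
    (hsq : ∑ i, f i ^ 2 = 1) (hf : ∀ i, |f i| ≤ a) (ha : a ^ 2 ≤ 1 / 2) :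
    ∑ i, 2 * f i ^ 2 * Real.log (f i) ≤ -Real.log 2 := by
  have key : ∀ i ∈ Finset.univ, 2 * f i ^ 2 * Real.log (f i) ≤ f i ^ 2 * -Real.log 2 := by
    intro i _
    rcases eq_or_ne (f i) 0 with h0 | h0
    · simp [h0]
    have h1 : f i ^ 2 ≤ 1 / 2 := by
      rw [← sq_abs]
      exact (pow_le_pow_left₀ (abs_nonneg _) (hf i) 2).trans ha
    have h2 := Real.log_le_log (by positivity) h1
    rw [Real.log_pow, one_div, Real.log_inv] at h2
    push_cast at h2
    nlinarith [sq_nonneg (f i)]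
  refine (Finset.sum_le_sum key).trans (le_of_eq ?_)
  rw [← Finset.sum_mul, hsq, one_mul]

lemma sum_sq_mul_log_le_of_max {d : ℕ} (hd : 3 ≤ d) (f : Fin d → ℝ) (hsum : ∑ i, f i = 0)
    (hsq : ∑ i, f i ^ 2 = 1) (i₀ : Fin d) (hpos : 0 < f i₀) (hmax : ∀ i, |f i| ≤ f i₀) :
    ∑ i, 2 * f i ^ 2 * Real.log (f i) ≤ restrictedConst d - Real.log d := by
  have hd3 : (3 : ℝ) ≤ d := by exact_mod_cast hd
  rcases le_or_gt (f i₀ ^ 2) (1 / 2) with hhalf | hhalf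
  · exact (sum_sq_mul_log_le_of_abs_le f hsq hmax hhalf).trans
      (neg_log_two_le_restrictedConst_sub hd)
  set a := f i₀ with ha
  set s := Finset.univ.erase i₀ with hs
  have hcard : (s.card : ℝ) = d - 1 := by
    rw [hs, Finset.card_erase_of_mem (Finset.mem_univ _), Finset.card_univ, Fintype.card_fin,
      Nat.cast_pred (by omega)]
  have hsplit : ∀ g : Fin d → ℝ, ∑ i, g i = g i₀ + ∑ i ∈ s, g i := fun g =>
    (Finset.add_sum_erase _ g (Finset.mem_univ i₀)).symm
  have hy : ∑ i ∈ s, -f i = a := by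
    rw [Finset.sum_neg_distrib]
    linarith [hsplit f]
  have hy2 : ∑ i ∈ s, (-f i) ^ 2 = 1 - a ^ 2 := by
    simp only [neg_sq]
    linarith [hsplit fun i => f i ^ 2]
  have hgoal : ∑ i, 2 * f i ^ 2 * Real.log (f i) =
      2 * a ^ 2 * Real.log a + ∑ i ∈ s, 2 * (-f i) ^ 2 * Real.log (-f i) := by
    simp only [neg_sq, Real.log_neg_eq_log]
    exact hsplit _
  rw [hgoal]
  have hcs : a ^ 2 ≤ (d - 1) * (1 - a ^ 2) := by
    have h := sq_sum_le_card_mul_sum_sq (s := s) (f := fun i => -f i)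
    rwa [hy, hy2, hcard] at h
  have hb2 : 0 < 1 - a ^ 2 := by
    by_contra h
    nlinarith
  obtain ⟨b, hb, hbsq⟩ : ∃ b : ℝ, 0 < b ∧ b ^ 2 = 1 - a ^ 2 :=
    ⟨√(1 - a ^ 2), Real.sqrt_pos.2 hb2, Real.sq_sqrt hb2.le⟩
  have hab : b < a := lt_of_pow_lt_pow_left₀ 2 hpos.le (by linarith)
  have hΔ : 0 < a - b := by linarith
  have h1 : a ^ 2 + b ^ 2 = 1 := by linarith
  rw [← hbsq] at hy2
  unfold restrictedConst
  split_ifs with h6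
  · have h6' : (d : ℝ) ≤ 6 := by exact_mod_cast h6
    have hR : 3.236 ≤ 4 * b / (a - b) := by
      rw [le_div_iff₀ hΔ]
      have h : a ≤ 2.23607 * b := by
        refine abs_le_of_sq_le_sq' ?_ (by positivity) |>.2
        rw [mul_pow]
        nlinarith
      linarith
    have h := sum_sq_mul_log_le_of_two_large s (fun i => -f i) hb hab (N := 4) (κ := 4)
      (by norm_num) (by linarith) h1 hy hy2 (by norm_num)
      (by norm_num at hR; linarith) (logGap_four_nonpos hR)
    rw [Real.log_div (by linarith) two_ne_zero]
    norm_num at h ⊢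
    linarith
  · have h7 : 7 ≤ d := by omega
    have h7' : (7 : ℝ) ≤ d := by exact_mod_cast h7
    rcases le_or_gt (4 / 5) (a ^ 2) with h45 | h45
    · have h := sum_sq_mul_log_le_of_one_large s (fun i => -f i) hpos (n := d - 1) (by linarith)
        hcard hy (hy2.trans hbsq) (three_le_coeff (by linarith)) h45 rfl
        (logGap_half_nonneg (by linarith) rfl)
      rw [show (d : ℝ) - 1 + 1 = d by ring, show (d : ℝ) - 1 - 1 = d - 2 by ring] at h
      exact h
    · have hab2 : a ≤ 2 * b := by
        refine abs_le_of_sq_le_sq' ?_ (by positivity) |>.2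
        rw [mul_pow]
        linarith
      have hR : 5 ≤ ((d : ℝ) - 2) * b / (a - b) := by
        rw [le_div_iff₀ hΔ]
        nlinarith
      have h := sum_sq_mul_log_le_of_two_large s (fun i => -f i) hb hab (N := d - 2) (κ := 9 / 2)
        (by linarith) (by linarith) h1 hy hy2 (by norm_num) (by linarith)
        (logGap_nonpos_of_five_le hR)
      have hc := critical_le h7
      have h2 : 9 / 2 / ((d : ℝ) - 2) ≤ 1 := by
        rw [div_le_one (by linarith)]
        linarith
      have h3 : (a - b) ^ 2 ≤ 1 / 5 := by
        have : 2 / 5 ≤ a * b := by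
          refine abs_le_of_sq_le_sq' (a := 2 / 5) ?_ (by positivity) |>.2
          rw [mul_pow, hbsq]
          nlinarith
        nlinarith
      have h4 := mul_le_mul_of_nonneg_right h3 (sub_nonneg.2 h2)
      linarith

lemma sum_sq_mul_log_le_of_sum_sq_eq_one {d : ℕ} (hd : 3 ≤ d) (f : Fin d → ℝ)
    (hsum : ∑ i, f i = 0) (hsq : ∑ i, f i ^ 2 = 1) :
    ∑ i, 2 * f i ^ 2 * Real.log (f i) ≤ restrictedConst d - Real.log d := by
  obtain ⟨i₀, -, hi₀⟩ := Finset.exists_max_image Finset.univ (fun i => |f i|)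
    ⟨⟨0, by omega⟩, Finset.mem_univ _⟩
  have hmax : ∀ i, |f i| ≤ |f i₀| := fun i => hi₀ i (Finset.mem_univ i)
  rcases lt_trichotomy (f i₀) 0 with h | h | h
  · have := sum_sq_mul_log_le_of_max hd (fun i => -f i) (by simp [hsum]) (by simpa using hsq) i₀
      (by simpa using h) (by simpa [abs_of_neg h] using hmax)
    simpa only [neg_sq, Real.log_neg_eq_log] using this
  · have h0 : ∀ i, f i = 0 := fun i => abs_nonpos_iff.1 (by simpa [h] using hmax i)
    simp [h0] at hsq
  · exact sum_sq_mul_log_le_of_max hd f hsum hsq i₀ h (by simpa [abs_of_pos h] using hmax)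

lemma sum_lt_sq_sub {d : ℕ} (f : Fin d → ℝ) :
    (∑ i : Fin d, ∑ j : Fin d, if i < j then (f i - f j) ^ 2 else 0) =
      d * ∑ i, f i ^ 2 - (∑ i, f i) ^ 2 := by
  have hswap : (∑ i : Fin d, ∑ j : Fin d, if i < j then (f i - f j) ^ 2 else 0) =
      ∑ i : Fin d, ∑ j : Fin d, if j < i then (f i - f j) ^ 2 else 0 := by
    rw [Finset.sum_comm]
    refine Finset.sum_congr rfl fun i _ => Finset.sum_congr rfl fun j _ => ?_
    split_ifs
    · ring
    · rfl
  have hadd : (∑ i : Fin d, ∑ j : Fin d, if i < j then (f i - f j) ^ 2 else 0) +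
      (∑ i : Fin d, ∑ j : Fin d, if j < i then (f i - f j) ^ 2 else 0) =
      ∑ i : Fin d, ∑ j : Fin d, (f i ^ 2 + f j ^ 2 - 2 * (f i * f j)) := by
    rw [← Finset.sum_add_distrib]
    refine Finset.sum_congr rfl fun i _ => ?_
    rw [← Finset.sum_add_distrib]
    refine Finset.sum_congr rfl fun j _ => ?_
    rcases lt_trichotomy i j with h | rfl | h
    · rw [if_pos h, if_neg h.asymm]
      ring
    · simp only [lt_irrefl, if_false]
      ring
    · rw [if_pos h, if_neg h.asymm]
      ring
  have htot : ∑ i : Fin d, ∑ j : Fin d, (f i ^ 2 + f j ^ 2 - 2 * (f i * f j)) =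
      2 * (d * ∑ i, f i ^ 2) - 2 * (∑ i, f i) ^ 2 := by
    simp only [Finset.sum_sub_distrib, Finset.sum_add_distrib, Finset.sum_const, Finset.card_univ,
      Fintype.card_fin, nsmul_eq_mul, ← Finset.mul_sum, ← Finset.sum_mul]
    ring
  linarith

/-- Homogeneous form of `sum_sq_mul_log_le_of_sum_sq_eq_one`. -/
lemma sum_sq_mul_log_sq_le {d : ℕ} (hd : 3 ≤ d) (f : Fin d → ℝ) (hsum : ∑ i, f i = 0) :
    ∑ i, f i ^ 2 * Real.log (f i ^ 2) ≤
      (∑ i, f i ^ 2) * (Real.log (∑ i, f i ^ 2) + restrictedConst d - Real.log d) := by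
  set S := ∑ i, f i ^ 2 with hS
  have hS0 : 0 ≤ S := Finset.sum_nonneg fun i _ => sq_nonneg (f i)
  rcases hS0.eq_or_lt with h0 | hpos
  · have hf : ∀ i, f i ^ 2 = 0 := fun i =>
      (Finset.sum_eq_zero_iff_of_nonneg fun i _ => sq_nonneg (f i)).1 h0.symm i (Finset.mem_univ i)
    simp [← h0, hf]
  have hr : 0 < √S := Real.sqrt_pos.2 hpos
  have h := sum_sq_mul_log_le_of_sum_sq_eq_one hd (fun i => f i / √S)
    (by rw [← Finset.sum_div, hsum, zero_div])
    (by simp only [div_pow, Real.sq_sqrt hS0, ← Finset.sum_div]; exact div_self hpos.ne')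
  have hterm : ∀ i, 2 * (f i / √S) ^ 2 * Real.log (f i / √S) =
      (f i ^ 2 * Real.log (f i ^ 2) - f i ^ 2 * Real.log S) / S := by
    intro i
    rcases eq_or_ne (f i) 0 with hi | hi
    · simp [hi]
    rw [Real.log_div hi hr.ne', Real.log_sqrt hS0, Real.log_pow, div_pow, Real.sq_sqrt hS0]
    push_cast
    ring
  simp only [hterm] at h
  rw [← Finset.sum_div, Finset.sum_sub_distrib, ← Finset.sum_mul, ← hS, div_le_iff₀ hpos] at h
  linarith


/-- Restricted log-Sobolev inequality on the complete graph: for `d ≥ 3` and any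
`f : {1,…,d} → ℝ` with `∑ f(i) = 0`, one has
`Ent_π(f²) ≤ ((d-1)/d) δ_d E(f,f)` where `π` is the uniform measure,
`E(f,f) = (1/(d(d-1))) ∑_{i<j} (f(i)-f(j))²`, and `δ_d = log(d/2)` for `d ≤ 6`,
`δ_d = ((d-2)/d) log(d-1)` for `d ≥ 7`. -/
theorem restricted_logSobolev_complete_graph (d : ℕ) (hd : 3 ≤ d) (f : Fin d → ℝ)
    (hsum : (∑ i, f i) = 0) :
    (1 / d : ℝ) * (∑ i, (f i) ^ 2 * Real.log ((f i) ^ 2)) -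
        ((1 / d : ℝ) * ∑ i, (f i) ^ 2) * Real.log ((1 / d : ℝ) * ∑ i, (f i) ^ 2) ≤
      ((d - 1 : ℝ) / d) *
        (if d ≤ 6 then Real.log ((d : ℝ) / 2) else ((d - 2 : ℝ) / d) * Real.log (d - 1)) *
        ((1 / ((d : ℝ) * ((d : ℝ) - 1))) *
          ∑ i : Fin d, ∑ j : Fin d, if i < j then (f i - f j) ^ 2 else 0) := by
  have hd3 : (3 : ℝ) ≤ d := by exact_mod_cast hd
  have h := sum_sq_mul_log_sq_le hd f hsum
  rw [sum_lt_sq_sub, hsum]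
  change _ ≤ ((d - 1 : ℝ) / d) * restrictedConst d * _
  set S := ∑ i, f i ^ 2 with hS
  have hS0 : 0 ≤ S := Finset.sum_nonneg fun i _ => sq_nonneg (f i)
  have hlog : S * Real.log (1 / d * S) = S * (Real.log S - Real.log d) := by
    rcases hS0.eq_or_lt with h0 | hpos
    · simp [← h0]
    · rw [one_div, Real.log_mul (by positivity) hpos.ne', Real.log_inv]
      ring
  have hrhs : ((d - 1 : ℝ) / d) * restrictedConst d *
      (1 / ((d : ℝ) * (d - 1)) * (d * S - 0 ^ 2)) = 1 / d * (S * restrictedConst d) := by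
    have : (d : ℝ) - 1 ≠ 0 := by linarith
    field_simp
    ring
  rw [hrhs, mul_assoc (1 / (d : ℝ)), hlog, ← mul_sub]
  refine mul_le_mul_of_nonneg_left ?_ (by positivity)
  linarith
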